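/- Fix a positive integer n and φ ∈ ℝ, and for r > 0 set a_r = r·e^{iφ} and s_r = r^{1/2}·e^{iφ/2}. Then the n+1 roots, counted with multiplicity, of the polynomial λ ↦ Sp_n(a_r, λ) can be labeled λ_0(r), λ_1(r), …, λ_n(r) in such a way that for every j ∈ {0,…,n}, λ_j(r)/s_r → n − 2j as r → +∞. In particular, for all sufficiently large r all these roots are simple, and after division by n·s_r they are asymptotically the n+1 equally spaced points −1, −1+2/n, …, 1 of the segment [−1,1]. -/

import Mathlib

open Filter

/-- The `(n+1) × (n+1)` matrix `M_n^{(a)}` of the operator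
`T_n(y) = y'' - (x² - a) y' + n x y` in the monomial basis `1, x, …, xⁿ`. -/
def Mmat (n : ℕ) (a : ℂ) : Matrix (Fin (n + 1)) (Fin (n + 1)) ℂ :=
  Matrix.of fun i j =>
    if (j : ℕ) = (i : ℕ) + 1 then ((i : ℕ) + 1 : ℂ) * a
    else if (j : ℕ) = (i : ℕ) + 2 then ((i : ℕ) + 1 : ℂ) * ((i : ℕ) + 2 : ℂ)
    else if (i : ℕ) = (j : ℕ) + 1 then (n : ℂ) - (j : ℕ)
    else 0

/-- The spectral polynomial `Sp_n(a, λ) = det (M_n^{(a)} - λ·Id)` as a polynomial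
in the variable `λ`. -/
noncomputable def SpPoly (n : ℕ) (a : ℂ) : Polynomial ℂ :=
  Matrix.det
    ((Mmat n a).map Polynomial.C -
      (Polynomial.X : Polynomial ℂ) • (1 : Matrix (Fin (n + 1)) (Fin (n + 1)) (Polynomial ℂ)))

open Polynomial in
/-- The eigenpolynomial of the Kac operator. -/
noncomputable def kacPoly (n j : ℕ) : Polynomial ℂ :=
  (1 + X) ^ (n - j) * (1 - X) ^ j

/-- The rescaled matrix. -/
def Kmat (n : ℕ) (e : ℂ) : Matrix (Fin (n + 1)) (Fin (n + 1)) ℂ :=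
  Matrix.of fun i j =>
    if (j : ℕ) = (i : ℕ) + 1 then ((i : ℕ) + 1 : ℂ)
    else if (j : ℕ) = (i : ℕ) + 2 then e * (((i : ℕ) + 1 : ℂ) * ((i : ℕ) + 2 : ℂ))
    else if (i : ℕ) = (j : ℕ) + 1 then (n : ℂ) - (j : ℕ)
    else 0

open Polynomial in
lemma kacPoly_ode (n j : ℕ) (hj : j ≤ n) :
    (1 - X ^ 2) * derivative (kacPoly n j) + C (n : ℂ) * X * kacPoly n j
      = C ((n : ℂ) - 2 * j) * kacPoly n j := by
  obtain ⟨m, rfl⟩ := Nat.exists_eq_add_of_le hj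
  have h1 : ∀ k : ℕ, (1 + X) * derivative ((1 + X : ℂ[X]) ^ k) = C (k : ℂ) * (1 + X) ^ k := by
    intro k
    rcases k with _ | k
    · simp
    · rw [derivative_pow_succ]; simp; ring
  have h2 : ∀ k : ℕ, (1 - X) * derivative ((1 - X : ℂ[X]) ^ k) = - C (k : ℂ) * (1 - X) ^ k := by
    intro k
    rcases k with _ | k
    · simp
    · rw [derivative_pow_succ]; simp; ring
  have e1 := h1 m
  have e2 := h2 j
  unfold kacPoly
  rw [derivative_mul]
  simp only [Nat.add_sub_cancel_left, map_sub, map_mul, Nat.cast_add, map_add]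
  have : (C 2 : ℂ[X]) = 2 := rfl
  rw [this]
  linear_combination ((1 - X) * (1 - X) ^ j) * e1 + ((1 + X) * (1 + X) ^ m) * e2

open Polynomial in
lemma kacPoly_natDegree (n j : ℕ) (hj : j ≤ n) : (kacPoly n j).natDegree ≤ n := by
  unfold kacPoly
  have h1 : (1 + X : ℂ[X]).natDegree ≤ 1 := by compute_degree
  have h2 : (1 - X : ℂ[X]).natDegree ≤ 1 := by compute_degree
  have h3 := natDegree_pow_le_of_le (n - j) h1
  have h4 := natDegree_pow_le_of_le j h2
  have := natDegree_mul_le_of_le h3 h4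
  omega

open Polynomial in
lemma kacPoly_coeff_zero (n j : ℕ) : (kacPoly n j).coeff 0 = 1 := by
  simp [kacPoly, coeff_zero_eq_eval_zero]

open Polynomial in
lemma kac_mulVec (n j : ℕ) (hj : j ≤ n) :
    (Kmat n 0).mulVec (fun i => (kacPoly n j).coeff i)
      = ((n : ℂ) - 2 * j) • (fun i : Fin (n + 1) => (kacPoly n j).coeff i) := by
  funext i
  have hode := congrArg (fun p => p.coeff (i : ℕ)) (kacPoly_ode n j hj)
  have hdeg : (kacPoly n j).coeff (n + 1) = 0 :=
    coeff_eq_zero_of_natDegree_lt (Nat.lt_succ_of_le (kacPoly_natDegree n j hj))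
  generalize kacPoly n j = y at *
  obtain ⟨i, hi⟩ := i
  have key : ∀ k : Fin (n + 1), (Kmat n 0) ⟨i, hi⟩ k * y.coeff k =
      (fun k : ℕ => (if k = i + 1 then ((i : ℂ) + 1) * y.coeff k else 0)
        + (if i = k + 1 then ((n : ℂ) - k) * y.coeff k else 0)) k := by
    intro k
    simp only [Kmat, Matrix.of_apply]
    split_ifs <;> first | omega | simp
  simp only [Matrix.mulVec, dotProduct]
  rw [Finset.sum_congr rfl (fun k _ => key k), Fin.sum_univ_eq_sum_range
    (fun k : ℕ => (if k = i + 1 then ((i : ℂ) + 1) * y.coeff k else 0)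
        + (if i = k + 1 then ((n : ℂ) - k) * y.coeff k else 0)) (n + 1),
    Finset.sum_add_distrib, Finset.sum_ite_eq']
  have hA : (if i + 1 ∈ Finset.range (n + 1) then ((i : ℂ) + 1) * y.coeff (i + 1) else 0)
      = ((i : ℂ) + 1) * y.coeff (i + 1) := by
    split_ifs with h
    · rfl
    · have : i = n := by simp at h; omega
      subst this; rw [hdeg]; simp
  rw [hA]
  simp only [Pi.smul_apply, smul_eq_mul]
  rw [show (1 - X ^ 2) * derivative y + C (n : ℂ) * X * y
    = derivative y - X * (X * derivative y) + C (n : ℂ) * (X * y) by ring] at hode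
  rcases i with _ | i
  · simp [coeff_derivative] at hode ⊢
    rw [← hode]
  · have hB : ∑ k ∈ Finset.range (n + 1),
        (if i + 1 = k + 1 then ((n : ℂ) - k) * y.coeff k else 0) = ((n : ℂ) - i) * y.coeff i := by
      rw [Finset.sum_eq_single i]
      · simp
      · intro b _ hb; rw [if_neg]; omega
      · intro h; simp at h; omega
    rw [hB]
    rcases i with _ | i
    · simp only [coeff_C_mul, coeff_add, coeff_sub] at hode
      simp [coeff_derivative, coeff_X_mul] at hode ⊢
      rw [← hode]; ring
    · simp only [coeff_add, coeff_sub, coeff_C_mul, coeff_X_mul, coeff_derivative] at hode ⊢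
      rw [← hode]; push_cast; ring

lemma kac_det (n j : ℕ) (hj : j ≤ n) :
    (Kmat n 0 - ((n : ℂ) - 2 * j) • (1 : Matrix (Fin (n + 1)) (Fin (n + 1)) ℂ)).det = 0 := by
  apply Matrix.exists_mulVec_eq_zero_iff.mp
  refine ⟨fun i => (kacPoly n j).coeff i, ?_, ?_⟩
  · intro h
    have := congrFun h 0
    simp [kacPoly_coeff_zero] at this
  · rw [Matrix.sub_mulVec, kac_mulVec n j hj, Matrix.smul_mulVec, Matrix.one_mulVec, sub_self]

lemma scale_det (n : ℕ) (s x : ℂ) (hs : s ≠ 0) :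
    (Mmat n (s ^ 2) - (s * x) • (1 : Matrix (Fin (n + 1)) (Fin (n + 1)) ℂ)).det
      = s ^ (n + 1) * (Kmat n ((s ^ 3)⁻¹)
          - x • (1 : Matrix (Fin (n + 1)) (Fin (n + 1)) ℂ)).det := by
  set D : Matrix (Fin (n + 1)) (Fin (n + 1)) ℂ := Matrix.diagonal fun i => s ^ (i : ℕ) with hD
  have hDd : D.det ≠ 0 := by
    rw [hD, Matrix.det_diagonal]
    exact Finset.prod_ne_zero_iff.mpr fun i _ => pow_ne_zero _ hs
  have h : D * (Mmat n (s ^ 2) - (s * x) • (1 : Matrix (Fin (n + 1)) (Fin (n + 1)) ℂ))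
      = s • ((Kmat n ((s ^ 3)⁻¹) - x • (1 : Matrix (Fin (n + 1)) (Fin (n + 1)) ℂ)) * D) := by
    ext i j
    rw [hD, Matrix.diagonal_mul, Matrix.smul_apply, Matrix.mul_diagonal]
    simp only [Matrix.sub_apply, Matrix.smul_apply, Matrix.one_apply, Mmat, Kmat, Matrix.of_apply,
      smul_eq_mul, Fin.ext_iff]
    by_cases hd : (i : ℕ) = j
    · have h1 : ¬ (j : ℕ) = i + 1 := by omega
      have h2 : ¬ (j : ℕ) = i + 2 := by omega
      have h3 : ¬ (i : ℕ) = j + 1 := by omega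
      rw [if_neg h1, if_neg h2, if_neg h3, if_neg h1, if_neg h2, if_pos hd, hd]
      ring
    rw [if_neg hd]
    by_cases h1 : (j : ℕ) = i + 1
    · rw [if_pos h1, if_pos h1, h1]; ring
    rw [if_neg h1, if_neg h1]
    by_cases h2 : (j : ℕ) = i + 2
    · rw [if_pos h2, if_pos h2, h2]; field_simp; ring
    rw [if_neg h2, if_neg h2]
    by_cases h3 : (i : ℕ) = j + 1
    · rw [if_pos h3, h3]; ring
    rw [if_neg h3]; ring
  have h' := congrArg Matrix.det h
  rw [Matrix.det_mul, Matrix.det_smul, Matrix.det_mul, Fintype.card_fin] at h'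
  apply mul_left_cancel₀ hDd
  rw [h']; ring

lemma spPoly_eq (n : ℕ) (a : ℂ) :
    SpPoly n a = Polynomial.C ((-1 : ℂ) ^ (n + 1)) * (Mmat n a).charpoly := by
  unfold SpPoly Matrix.charpoly
  have : ((Mmat n a).map Polynomial.C - (Polynomial.X : Polynomial ℂ) •
      (1 : Matrix (Fin (n + 1)) (Fin (n + 1)) (Polynomial ℂ))) = - (Mmat n a).charmatrix := by
    rw [Matrix.charmatrix, neg_sub, Matrix.smul_one_eq_diagonal]
    rfl
  rw [this, Matrix.det_neg]
  simp

lemma spPoly_roots (n : ℕ) (a : ℂ) : (SpPoly n a).roots = (Mmat n a).charpoly.roots := by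
  rw [spPoly_eq, Polynomial.roots_C_mul _ (by simp)]

lemma exists_label (n : ℕ) (a : ℂ) : ∃ m : Fin (n + 1) → ℂ,
    (SpPoly n a).roots = Multiset.map m Finset.univ.val := by
  have hc : Multiset.card (SpPoly n a).roots = n + 1 := by
    rw [spPoly_roots, IsAlgClosed.card_roots_eq_natDegree, Matrix.charpoly_natDegree_eq_dim,
      Fintype.card_fin]
  have hl : (SpPoly n a).roots.toList.length = n + 1 := by simp [hc]
  refine ⟨fun i => (SpPoly n a).roots.toList.get (i.cast hl.symm), ?_⟩
  conv_lhs => rw [← Multiset.coe_toList (SpPoly n a).roots]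
  rw [Fin.univ_val_map, Multiset.coe_eq_coe]
  apply List.Perm.of_eq
  apply List.ext_get
  · simp [hc]
  · intro k h1 h2
    rw [List.get_ofFn]
    simp

lemma norm_det_eq (n : ℕ) (a x : ℂ) (m : Fin (n + 1) → ℂ)
    (hm : (SpPoly n a).roots = Multiset.map m Finset.univ.val) :
    ‖(Mmat n a - x • (1 : Matrix (Fin (n + 1)) (Fin (n + 1)) ℂ)).det‖ = ∏ i, ‖m i - x‖ := by
  rw [spPoly_roots] at hm
  have h1 : (Mmat n a).charpoly.eval x = ∏ i, (x - m i) := by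
    rw [(IsAlgClosed.splits (Mmat n a).charpoly).eq_prod_roots_of_monic
      (Matrix.charpoly_monic _), hm, Multiset.map_map]
    rw [Polynomial.eval_multiset_prod, Multiset.map_map]
    simp [Finset.prod]
  rw [Matrix.eval_charpoly] at h1
  have h2 : Mmat n a - x • (1 : Matrix (Fin (n + 1)) (Fin (n + 1)) ℂ)
      = -(Matrix.scalar (Fin (n + 1)) x - Mmat n a) := by
    rw [neg_sub, Matrix.smul_one_eq_diagonal]; rfl
  rw [h2, Matrix.det_neg, h1]
  simp [norm_sub_rev]

/-- The quantity controlling the distance of the rescaled roots from their limits. -/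
lemma kac_tendsto (n j : ℕ) (hj : j ≤ n) (s : ℝ → ℂ)
    (hs : Tendsto (fun r => ‖s r‖) atTop atTop) :
    Tendsto (fun r => ‖(Kmat n ((s r ^ 3)⁻¹)
      - ((n : ℂ) - 2 * j) • (1 : Matrix (Fin (n + 1)) (Fin (n + 1)) ℂ)).det‖)
      atTop (nhds 0) := by
  have hc : Continuous fun e : ℂ => ‖(Kmat n e
      - ((n : ℂ) - 2 * j) • (1 : Matrix (Fin (n + 1)) (Fin (n + 1)) ℂ)).det‖ := by
    apply Continuous.norm
    apply Continuous.matrix_det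
    apply Continuous.sub _ continuous_const
    apply continuous_matrix
    intro i k
    simp only [Kmat, Matrix.of_apply]
    split_ifs <;> fun_prop
  have h0 := hc.tendsto 0
  simp only [kac_det n j hj, norm_zero] at h0
  apply h0.comp
  rw [tendsto_zero_iff_norm_tendsto_zero]
  simp only [norm_inv, norm_pow]
  exact tendsto_inv_atTop_zero.comp ((tendsto_pow_atTop (by norm_num)).comp hs)

/-- Fix `n ≥ 1` and `φ ∈ ℝ`; for `r > 0` put `a_r = r·e^{iφ}` and
`s_r = √r·e^{iφ/2}`. The `n+1` roots (with multiplicity) of `Sp_n(a_r, ·)` can be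
labeled `λ_0(r), …, λ_n(r)` so that `λ_j(r)/s_r → n − 2j` as `r → +∞`. -/
theorem roots_asymptotically_equally_spaced (n : ℕ) (hn : 0 < n) (φ : ℝ) :
    ∃ L : ℝ → Fin (n + 1) → ℂ,
      (∀ r : ℝ, 0 < r →
        (SpPoly n ((r : ℂ) * Complex.exp (Complex.I * (φ : ℂ)))).roots =
          Multiset.map (L r) Finset.univ.val) ∧
      ∀ j : Fin (n + 1),
        Tendsto
          (fun r : ℝ =>
            L r j / ((Real.sqrt r : ℂ) * Complex.exp (Complex.I * (φ : ℂ) / 2)))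
          atTop (nhds ((n : ℂ) - 2 * ((j : ℕ) : ℂ))) := by
  classical
  choose m hm using fun r : ℝ => exists_label n ((r : ℂ) * Complex.exp (Complex.I * (φ : ℂ)))
  set s : ℝ → ℂ := fun r => (Real.sqrt r : ℂ) * Complex.exp (Complex.I * (φ : ℂ) / 2) with hsdef
  have hs2 : ∀ r : ℝ, 0 < r → (r : ℂ) * Complex.exp (Complex.I * (φ : ℂ)) = s r ^ 2 := by
    intro r hr
    simp only [hsdef, mul_pow]
    rw [← Complex.exp_nat_mul, ← Complex.ofReal_pow, Real.sq_sqrt hr.le]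
    congr 2
    push_cast; ring
  have hs0 : ∀ r : ℝ, 0 < r → s r ≠ 0 := by
    intro r hr
    apply mul_ne_zero _ (Complex.exp_ne_zero _)
    exact_mod_cast (Real.sqrt_pos.mpr hr).ne'
  have hsn : Tendsto (fun r => ‖s r‖) atTop atTop := by
    have : (fun r => ‖s r‖) = fun r => Real.sqrt r := by
      funext r
      simp only [hsdef, norm_mul, Complex.norm_real, Complex.norm_exp]
      simp [abs_of_nonneg (Real.sqrt_nonneg r)]
    rw [this]
    exact Real.tendsto_sqrt_atTop
  have hmin : ∀ (r : ℝ) (j : Fin (n + 1)), ∃ k : Fin (n + 1), ∀ i : Fin (n + 1),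
      ‖m r k / s r - ((n : ℂ) - 2 * ((j : ℕ) : ℂ))‖
        ≤ ‖m r i / s r - ((n : ℂ) - 2 * ((j : ℕ) : ℂ))‖ := fun r j => Finite.exists_min _
  choose k hk using hmin
  have hbound : ∀ (r : ℝ) (j : Fin (n + 1)), 0 < r →
      ‖m r (k r j) / s r - ((n : ℂ) - 2 * ((j : ℕ) : ℂ))‖ ^ (n + 1) ≤
        ‖(Kmat n ((s r ^ 3)⁻¹)
      - ((n : ℂ) - 2 * (j : ℕ)) • (1 : Matrix (Fin (n + 1)) (Fin (n + 1)) ℂ)).det‖ := by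
    intro r j hr
    have h1 := norm_det_eq n _ (s r * ((n : ℂ) - 2 * ((j : ℕ) : ℂ))) (m r) (hm r)
    rw [hs2 r hr, scale_det n _ _ (hs0 r hr), norm_mul, norm_pow] at h1
    have hsp : 0 < ‖s r‖ := norm_pos_iff.mpr (hs0 r hr)
    have h2 : ∏ i, ‖m r i - s r * ((n : ℂ) - 2 * ((j : ℕ) : ℂ))‖
        = ‖s r‖ ^ (n + 1) * ∏ i, ‖m r i / s r - ((n : ℂ) - 2 * ((j : ℕ) : ℂ))‖ := by
      have : ∀ i, ‖m r i - s r * ((n : ℂ) - 2 * ((j : ℕ) : ℂ))‖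
          = ‖s r‖ * ‖m r i / s r - ((n : ℂ) - 2 * ((j : ℕ) : ℂ))‖ := by
        intro i
        rw [← norm_mul, mul_sub (s r) (m r i / s r), mul_div_cancel₀ _ (hs0 r hr)]
      simp_rw [this]
      rw [Finset.prod_mul_distrib]
      simp
    rw [h2] at h1
    rw [mul_left_cancel₀ (pow_pos hsp _).ne' h1]
    calc _ = ∏ i : Fin (n + 1), ‖m r (k r j) / s r - ((n : ℂ) - 2 * ((j : ℕ) : ℂ))‖ := by simp
      _ ≤ _ := Finset.prod_le_prod (fun _ _ => norm_nonneg _) (fun i _ => hk r j i)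
  have hlim : ∀ j : Fin (n + 1), Tendsto (fun r => m r (k r j) / s r) atTop
      (nhds ((n : ℂ) - 2 * ((j : ℕ) : ℂ))) := by
    intro j
    have hT := kac_tendsto n j (Nat.lt_succ_iff.mp j.2) s hsn
    rw [Metric.tendsto_nhds]
    intro ε hε
    filter_upwards [hT.eventually (gt_mem_nhds (pow_pos hε (n + 1))), eventually_gt_atTop 0]
      with r h1 h2
    rw [dist_eq_norm]
    exact lt_of_pow_lt_pow_left₀ (n + 1) hε.le ((hbound r j h2).trans_lt h1)
  have hinj : ∀ᶠ r in atTop, Function.Injective (k r) := by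
    have hall : ∀ᶠ r in atTop, ∀ j : Fin (n + 1),
        dist (m r (k r j) / s r) ((n : ℂ) - 2 * ((j : ℕ) : ℂ)) < 1 :=
      eventually_all.mpr fun j => (Metric.tendsto_nhds.mp (hlim j)) 1 one_pos
    filter_upwards [hall] with r hr i j hij
    have hi := hr i
    have hj := hr j
    rw [hij] at hi
    have h := dist_triangle_left ((n : ℂ) - 2 * ((i : ℕ) : ℂ)) ((n : ℂ) - 2 * ((j : ℕ) : ℂ))
      (m r (k r j) / s r)
    have h3 : dist ((n : ℂ) - 2 * ((i : ℕ) : ℂ)) ((n : ℂ) - 2 * ((j : ℕ) : ℂ))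
        = ((2 * |((j : ℕ) : ℤ) - ((i : ℕ) : ℤ)| : ℤ) : ℝ) := by
      rw [dist_eq_norm, show (n : ℂ) - 2 * ((i : ℕ) : ℂ) - ((n : ℂ) - 2 * ((j : ℕ) : ℂ))
        = ((2 * (((j : ℕ) : ℤ) - ((i : ℕ) : ℤ)) : ℤ) : ℂ) by push_cast; ring, Complex.norm_intCast]
      push_cast
      rw [abs_mul]; simp
    have h4 : ((2 * |((j : ℕ) : ℤ) - ((i : ℕ) : ℤ)| : ℤ) : ℝ) < ((2 : ℤ) : ℝ) := by
      rw [← h3]; push_cast; linarith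
    have h5 := Int.cast_lt.mp h4
    have h6 : |((j : ℕ) : ℤ) - ((i : ℕ) : ℤ)| < 1 := by omega
    rw [Int.abs_lt_one_iff] at h6
    apply Fin.ext; omega
  refine ⟨fun r => if Function.Injective (k r) then m r ∘ k r else m r, ?_, ?_⟩
  · intro r hr
    rw [hm r]
    dsimp only
    split_ifs with h
    · have hb : Function.Bijective (k r) := Finite.injective_iff_bijective.mp h
      rw [← Multiset.map_map]
      congr 1
      have := congrArg Finset.val (Finset.map_univ_equiv (Equiv.ofBijective _ hb))
      rw [Finset.map_val] at this
      exact this.symm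
    · rfl
  · intro j
    apply (hlim j).congr'
    filter_upwards [hinj] with r hr
    simp [hr, hsdef]
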